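/- Let d, n ∈ ℕ with 1 ≤ d < n and let f : {-1,1}^n → ℝ^d. Then there exist a subset σ ⊆ {1,…,n} with |σ| = d, a bias vector 𝛂 = (α_i)_{i∈σ} ∈ [0,1]^σ, and a point w ∈ {-1,1}^{σ^c} such that ∫_{{-1,1}^σ} f(x, w) dμ_𝛂(x) = ∫_{{-1,1}^σ} f(−x, −w) dμ_𝛂(x). -/

import Mathlib

open Finset

noncomputable section

/-- The real sign of a Boolean coordinate: `true ↦ 1`, `false ↦ -1`. -/
def sgn (b : Bool) : ℝ := if b then 1 else -1

/-- Hamming distance on the discrete cube `{-1,1}^n ≃ Bool^n`. -/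
def hamming {n : ℕ} (x y : Fin n → Bool) : ℕ :=
  (Finset.univ.filter fun i => x i ≠ y i).card

/-- Flip the `i`-th coordinate. -/
def flipc {ι : Type*} [DecidableEq ι] (x : ι → Bool) (i : ι) : ι → Bool :=
  Function.update x i (!(x i))

/-- Negate all coordinates (the antipodal map). -/
def negc {ι : Type*} (x : ι → Bool) : ι → Bool := fun i => !(x i)

/-- `X` has Rademacher type `p` with constant `T`. -/
def RademacherType (X : Type*) [NormedAddCommGroup X] [NormedSpace ℝ X] (p T : ℝ) : Prop :=
  ∀ (m : ℕ) (v : Fin m → X),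
    (2 ^ m : ℝ)⁻¹ * ∑ x : Fin m → Bool, ‖∑ i, sgn (x i) • v i‖ ^ p ≤
      T ^ p * ∑ i, ‖v i‖ ^ p

/-- `X` has cotype `q` with constant `Cq`. -/
def CotypeC (X : Type*) [NormedAddCommGroup X] [NormedSpace ℝ X] (q Cq : ℝ) : Prop :=
  ∀ (m : ℕ) (v : Fin m → X),
    (∑ i, ‖v i‖ ^ q) / Cq ^ q ≤
      (2 ^ m : ℝ)⁻¹ * ∑ x : Fin m → Bool, ‖∑ i, sgn (x i) • v i‖ ^ q

open scoped Classical in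
/-- The weak `ℓ_p` norm of a finite real vector. -/
def weakLp {ι : Type*} [Fintype ι] (p : ℝ) (w : ι → ℝ) : ℝ :=
  sSup {z | ∃ r : ℝ, 0 ≤ r ∧
    z = r * ((Finset.univ.filter fun i => r ≤ |w i|).card : ℝ) ^ (1 / p)}

/-- Metric stable type `p` with constant `S`. -/
def MetricStableType (M : Type*) [PseudoMetricSpace M] (p S : ℝ) : Prop :=
  ∀ (n : ℕ) (f : (Fin n → Bool) → M),
    (2 ^ n : ℝ)⁻¹ * ∑ x : Fin n → Bool, dist (f x) (f (negc x)) ^ p ≤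
      S ^ p * ((2 ^ n : ℝ)⁻¹ *
        ∑ x : Fin n → Bool, weakLp p (fun i => (1 / 2) * dist (f x) (f (flipc x i))) ^ p)

/-- The product biased measure weight of a point of the cube. -/
def biasedWeight {ι : Type*} [Fintype ι] (α : ι → ℝ) (x : ι → Bool) : ℝ :=
  ∏ i, if x i then α i else 1 - α i

/-- The biased discrete partial derivative `∂_i^α`. -/
def bder {ι : Type*} [DecidableEq ι] {X : Type*} [AddCommGroup X] [Module ℝ X]
    (α : ℝ) (i : ι) (f : (ι → Bool) → X) (x : ι → Bool) : X :=
  f x - (α • f (Function.update x i true) + (1 - α) • f (Function.update x i false))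

/-- The `L_p(μ; X)` norm with respect to the weight `μ` on the cube. -/
def lpNormW {ι : Type*} [Fintype ι] [DecidableEq ι] {X : Type*} [NormedAddCommGroup X]
    (μ : (ι → Bool) → ℝ) (p : ℝ) (g : (ι → Bool) → X) : ℝ :=
  (∑ x : ι → Bool, μ x * ‖g x‖ ^ p) ^ (1 / p)

/-- The Orlicz `L_p(log L)^{p/2}(μ; X)` norm with respect to the weight `μ` on the cube. -/
def orliczNormW {ι : Type*} [Fintype ι] [DecidableEq ι] {X : Type*} [NormedAddCommGroup X]
    (μ : (ι → Bool) → ℝ) (p : ℝ) (g : (ι → Bool) → X) : ℝ :=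
  sInf {γ : ℝ | 0 < γ ∧
    ∑ x : ι → Bool, (μ x * (‖g x‖ ^ p / γ ^ p)) *
      Real.log (Real.exp 1 + ‖g x‖ ^ p / γ ^ p) ^ (p / 2) ≤ 1}

/-- The one-dimensional transition kernel `p_t^α`. -/
def ptrans (t α : ℝ) : Bool → Bool → ℝ := fun a b =>
  match a, b with
  | true, true => 1 - (1 - Real.exp (-t)) * (1 - α)
  | true, false => (1 - Real.exp (-t)) * (1 - α)
  | false, true => (1 - Real.exp (-t)) * α
  | false, false => 1 - (1 - Real.exp (-t)) * α

/-- The matrix `η_t^α(·,·;θ)`. -/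
def eta (t α θ : ℝ) : Bool → Bool → ℝ := fun a b =>
  match a, b with
  | true, true => (Real.exp (-t) - θ) / ptrans t α true true
  | true, false => (-θ) / ptrans t α false true
  | false, true => (θ - Real.exp (-t)) / ptrans t α true false
  | false, false => θ / ptrans t α false false

/-- The product transition kernel `p_t^𝛂`. -/
def pprod {n : ℕ} (t : ℝ) (α : Fin n → ℝ) (x y : Fin n → Bool) : ℝ :=
  ∏ i, ptrans t (α i) (x i) (y i)

/-- Glue coordinates on `σ` (given by `x`) with coordinates off `σ` (given by `w`). -/
def glue {n : ℕ} (σ : Finset (Fin n)) (x : {i // i ∈ σ} → Bool) (w : Fin n → Bool) :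
    Fin n → Bool := fun j => if h : j ∈ σ then x ⟨j, h⟩ else w j

/-- The low-dimensional skeleton `𝒞_d^n` of the solid cube `[-1,1]^n`. -/
def cubeSkeleton (n d : ℕ) : Set (Fin n → ℝ) :=
  {x | (∀ i, |x i| ≤ 1) ∧ n - d ≤ {i | |x i| = 1}.ncard}

/-- The `ℓ_p^d` norm on `ℝ^d`. -/
def lpnorm (p : ℝ) {d : ℕ} (v : Fin d → ℝ) : ℝ := (∑ k, |v k| ^ p) ^ (1 / p)

/-! ### Cells of the cube as sign words

A list of signs encodes a face of a cube: the entry `0` marks a free coordinate. -/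

lemma neg_signType_ne_zero {s : SignType} (hs : s ≠ 0) : -s ≠ 0 := by
  revert s
  decide

/-- The mod 2 cubical coboundary of `ψ`, evaluated at a sign word. -/
def cobd : List SignType → (List SignType → ZMod 2) → ZMod 2
  | [], _ => 0
  | x :: l, ψ =>
    (if x = 0 then ψ (1 :: l) + ψ (-1 :: l) else 0) + cobd l (fun l' => ψ (x :: l'))

/-- `IsFace E F`: the cell `E` is a face of the cell `F`. -/
def IsFace (E F : List SignType) : Prop := List.Forall₂ (fun x y => x = y ∨ y = 0) E F

lemma IsFace.refl (F : List SignType) : IsFace F F := by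
  induction F with
  | nil => exact .nil
  | cons x l ih => exact .cons (.inl rfl) ih

lemma IsFace.trans {E F H : List SignType} (h : IsFace E F) (h' : IsFace F H) : IsFace E H := by
  induction h generalizing H with
  | nil => exact h'
  | cons hxy _ ih =>
    cases h' with
    | cons hyz h' =>
      refine .cons ?_ (ih h')
      rcases hyz with rfl | hyz
      · exact hxy
      · exact .inr hyz

lemma IsFace.getD {E F : List SignType} (h : IsFace E F) (i : ℕ) :
    E.getD i 0 = F.getD i 0 ∨ F.getD i 0 = 0 := by
  induction h generalizing i with
  | nil => simp
  | cons hxy _ ih =>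
    cases i with
    | zero => simpa using hxy
    | succ i => simpa using ih i

lemma cobd_congr {F : List SignType} {ψ ψ' : List SignType → ZMod 2}
    (h : ∀ E, IsFace E F → (∃ x ∈ E, x ≠ 0) → ψ E = ψ' E) : cobd F ψ = cobd F ψ' := by
  induction F generalizing ψ ψ' with
  | nil => rfl
  | cons x l ih =>
    simp only [cobd]
    congr 1
    · split_ifs with hx
      · rw [h (1 :: l) (.cons (.inr hx) (IsFace.refl l)) ⟨1, by simp, by decide⟩,
          h (-1 :: l) (.cons (.inr hx) (IsFace.refl l)) ⟨-1, by simp, by decide⟩]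
      · rfl
    · refine ih fun E hE ⟨y, hy, hy0⟩ => h _ (.cons (.inl rfl) hE) ⟨y, by simp [hy], hy0⟩

lemma cobd_add (F : List SignType) (ψ ψ' : List SignType → ZMod 2) :
    cobd F (fun l => ψ l + ψ' l) = cobd F ψ + cobd F ψ' := by
  induction F generalizing ψ ψ' with
  | nil => simp [cobd]
  | cons x l ih =>
    simp only [cobd, ih]
    split_ifs <;> ring

lemma cobd_const_mul (F : List SignType) (c : ZMod 2) (ψ : List SignType → ZMod 2) :
    cobd F (fun l => c * ψ l) = c * cobd F ψ := by
  induction F generalizing ψ with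
  | nil => simp [cobd]
  | cons x l ih =>
    simp only [cobd, ih]
    split_ifs <;> ring

lemma cobd_const (F : List SignType) (c : ZMod 2) : cobd F (fun _ => c) = 0 := by
  induction F with
  | nil => rfl
  | cons x l ih => simp [cobd, ih, CharTwo.add_self_eq_zero]

lemma cobd_cobd (F : List SignType) (ψ : List SignType → ZMod 2) :
    cobd F (fun l => cobd l ψ) = 0 := by
  induction F generalizing ψ with
  | nil => rfl
  | cons x l ih =>
    by_cases hx : x = 0
    · subst hx
      have h1 : (1 : SignType) ≠ 0 := by decide
      have h2 : (-1 : SignType) ≠ 0 := by decide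
      simp only [cobd, if_true, if_neg h1, if_neg h2, cobd_add, ih]
      simp only [zero_add, add_zero]
      exact CharTwo.add_self_eq_zero _
    · simp [cobd, hx, ih]

lemma cobd_map_neg (F : List SignType) (ψ : List SignType → ZMod 2) :
    cobd (F.map Neg.neg) ψ = cobd F (fun l => ψ (l.map Neg.neg)) := by
  induction F generalizing ψ with
  | nil => rfl
  | cons x l ih =>
    by_cases hx : x = 0
    · subst hx
      have h0 : (-0 : SignType) = 0 := by decide
      simp [cobd, ih, h0, add_comm]
    · have hx' : -x ≠ 0 := neg_signType_ne_zero hx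
      simp [cobd, hx, hx', ih]

/-- The cells of the `k`-dimensional alternating hemisphere of the `M`-cube: words with `k` zeros
which start with the sign `s` and change sign exactly at their zeros. -/
def hemisphere : ℕ → ℕ → SignType → List (List SignType)
  | 0, 0, _ => [[]]
  | _ + 1, 0, _ => []
  | 0, M + 1, s => (hemisphere 0 M s).map (s :: ·)
  | k + 1, M + 1, s =>
    (hemisphere (k + 1) M s).map (s :: ·) ++ (hemisphere k M (-s)).map (0 :: ·)

/-- The value of a cochain on the alternating hemisphere. -/
def hemiSum (k M : ℕ) (s : SignType) (ψ : List SignType → ZMod 2) : ZMod 2 :=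
  ((hemisphere k M s).map ψ).sum

lemma hemiSum_zero_succ (M : ℕ) (s : SignType) (ψ : List SignType → ZMod 2) :
    hemiSum 0 (M + 1) s ψ = hemiSum 0 M s (fun l => ψ (s :: l)) := by
  simp [hemiSum, hemisphere, Function.comp_def]

lemma hemiSum_succ_succ (k M : ℕ) (s : SignType) (ψ : List SignType → ZMod 2) :
    hemiSum (k + 1) (M + 1) s ψ =
      hemiSum (k + 1) M s (fun l => ψ (s :: l)) + hemiSum k M (-s) (fun l => ψ (0 :: l)) := by
  simp [hemiSum, hemisphere, Function.comp_def]

lemma hemiSum_add (k M : ℕ) (s : SignType) (ψ ψ' : List SignType → ZMod 2) :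
    hemiSum k M s (fun l => ψ l + ψ' l) = hemiSum k M s ψ + hemiSum k M s ψ' := by
  simp [hemiSum, List.sum_map_add]

lemma hemiSum_congr {k M : ℕ} {s : SignType} {ψ ψ' : List SignType → ZMod 2}
    (h : ∀ l ∈ hemisphere k M s, ψ l = ψ' l) : hemiSum k M s ψ = hemiSum k M s ψ' := by
  rw [hemiSum, hemiSum, List.map_congr_left h]

lemma hemisphere_neg (k M : ℕ) (s : SignType) :
    hemisphere k M (-s) = (hemisphere k M s).map (List.map Neg.neg) := by
  induction M generalizing k s with
  | zero => cases k <;> simp [hemisphere]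
  | succ M ih =>
    have h0 : (-0 : SignType) = 0 := by decide
    cases k <;> simp [hemisphere, ih, Function.comp_def, h0]

lemma hemiSum_neg (k M : ℕ) (s : SignType) (ψ : List SignType → ZMod 2) :
    hemiSum k M (-s) ψ = hemiSum k M s (fun l => ψ (l.map Neg.neg)) := by
  simp [hemiSum, hemisphere_neg, Function.comp_def]

lemma hemiSum_zero_cobd (M : ℕ) {s : SignType} (hs : s ≠ 0) (ψ : List SignType → ZMod 2) :
    hemiSum 0 M s (fun l => cobd l ψ) = 0 := by
  induction M generalizing ψ with
  | zero => simp [hemiSum, hemisphere, cobd]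
  | succ M ih => simp [hemiSum_zero_succ, cobd, hs, ih]

/-- The boundary of the `(k+1)`-hemisphere is the sum of the two antipodal `k`-hemispheres. -/
lemma hemiSum_cobd (k M : ℕ) {s : SignType} (hs : s ≠ 0) (ψ : List SignType → ZMod 2) :
    hemiSum (k + 1) M s (fun l => cobd l ψ) = hemiSum k M s ψ + hemiSum k M (-s) ψ := by
  induction M generalizing k s ψ with
  | zero => cases k <;> simp [hemiSum, hemisphere, CharTwo.add_self_eq_zero]
  | succ M ih =>
    have hs' : -s ≠ 0 := neg_signType_ne_zero hs
    have hsum : ∀ l, ψ (1 :: l) + ψ (-1 :: l) = ψ (s :: l) + ψ (-s :: l) := by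
      intro l
      rcases s with _ | _ | _
      · exact absurd rfl hs
      · exact add_comm _ _
      · rfl
    simp only [hemiSum_succ_succ, cobd, if_neg hs, if_true, zero_add, hemiSum_add, ih k hs, hsum]
    cases k with
    | zero =>
      simp only [hemiSum_zero_cobd M hs', hemiSum_zero_succ]
      linear_combination CharTwo.add_self_eq_zero (hemiSum 0 M (-s) fun l => ψ (s :: l))
    | succ k =>
      simp only [ih k hs', hemiSum_succ_succ, neg_neg]
      linear_combination CharTwo.add_self_eq_zero (hemiSum (k + 1) M (-s) fun l => ψ (s :: l))

lemma hemiSum_one (M : ℕ) (s : SignType) : hemiSum 0 M s (fun _ => 1) = 1 := by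
  induction M with
  | zero => simp [hemiSum, hemisphere]
  | succ M ih => rw [hemiSum_zero_succ, ih]

lemma sum_zeros_of_mem_hemisphere {k M : ℕ} {s : SignType} (hs : s ≠ 0) {l : List SignType}
    (hl : l ∈ hemisphere k M s) :
    ∑ i ∈ range M, (if l.getD i 0 = 0 then 1 else 0) = k := by
  induction M generalizing k s l with
  | zero => cases k <;> simp_all [hemisphere]
  | succ M ih =>
    have hs' : -s ≠ 0 := neg_signType_ne_zero hs
    rw [Finset.sum_range_succ']
    cases k with
    | zero =>
      simp only [hemisphere, List.mem_map] at hl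
      obtain ⟨l, hl, rfl⟩ := hl
      simpa [hs] using ih hs hl
    | succ k =>
      simp only [hemisphere, List.mem_map, List.mem_append] at hl
      rcases hl with ⟨l, hl, rfl⟩ | ⟨l, hl, rfl⟩
      · simpa [hs] using ih hs hl
      · simpa using ih hs' hl

lemma getD_zero_of_mem_hemisphere {k M : ℕ} {s : SignType} {l : List SignType}
    (hl : l ∈ hemisphere k M s) : l.getD 0 0 = s ∨ l.getD 0 0 = 0 := by
  cases M with
  | zero => cases k <;> simp_all [hemisphere]
  | succ M =>
    cases k with
    | zero =>
      simp only [hemisphere, List.mem_map] at hl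
      obtain ⟨l, hl, rfl⟩ := hl
      simp
    | succ k =>
      simp only [hemisphere, List.mem_map, List.mem_append] at hl
      rcases hl with ⟨l, hl, rfl⟩ | ⟨l, hl, rfl⟩ <;> simp

lemma getD_succ_of_mem_hemisphere {k M : ℕ} {s : SignType} {l : List SignType}
    (hl : l ∈ hemisphere k M s) (i : ℕ) :
    l.getD i 0 = l.getD (i + 1) 0 ∨ l.getD i 0 = 0 ∨ l.getD (i + 1) 0 = 0 := by
  induction M generalizing k s l i with
  | zero => cases k <;> simp_all [hemisphere]
  | succ M ih =>
    have key : ∀ (s : SignType) (l : List SignType) (k : ℕ), l ∈ hemisphere k M s →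
        (s :: l).getD i 0 = (s :: l).getD (i + 1) 0 ∨ (s :: l).getD i 0 = 0 ∨
          (s :: l).getD (i + 1) 0 = 0 := by
      intro s l k hl
      cases i with
      | zero =>
        rcases getD_zero_of_mem_hemisphere hl with h | h
        · left; simpa using h.symm
        · right; right; simpa using h
      | succ i => simpa using ih hl i
    cases k with
    | zero =>
      simp only [hemisphere, List.mem_map] at hl
      obtain ⟨l, hl, rfl⟩ := hl
      exact key s l 0 hl
    | succ k =>
      simp only [hemisphere, List.mem_map, List.mem_append] at hl
      rcases hl with ⟨l, hl, rfl⟩ | ⟨l, hl, rfl⟩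
      · exact key s l _ hl
      · cases i with
        | zero => simp
        | succ i => simpa using ih hl i

lemma exists_ne_zero_of_mem_hemisphere {k M : ℕ} (hk : k < M) {s : SignType} (hs : s ≠ 0)
    {l : List SignType} (hl : l ∈ hemisphere k M s) : ∃ x ∈ l, x ≠ 0 := by
  by_contra! h
  have h0 : ∀ i, l.getD i 0 = 0 := by
    intro i
    by_cases hi : i < l.length
    · rw [List.getD_eq_getElem _ _ hi]
      exact h _ (List.getElem_mem hi)
    · exact List.getD_eq_default _ _ (not_lt.mp hi)
  have := sum_zeros_of_mem_hemisphere hs hl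
  simp only [h0, if_true, sum_const, card_range, smul_eq_mul, mul_one] at this
  omega

/-- The mod 2 cubical cocycle representing the product of the coboundaries of `a 0, …, a (k-1)`. -/
def cupCochain (a : ℕ → List SignType → ZMod 2) : ℕ → List SignType → ZMod 2
  | 0, _ => 1
  | k + 1, F => cobd F (fun l => a k l * cupCochain a k l)

lemma cobd_cupCochain (a : ℕ → List SignType → ZMod 2) (k : ℕ) (F : List SignType) :
    cobd F (cupCochain a k) = 0 := by
  cases k with
  | zero => exact cobd_const F 1
  | succ k => exact cobd_cobd F _

lemma cupCochain_map_neg {a : ℕ → List SignType → ZMod 2}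
    (ha : ∀ k l, (∃ x ∈ l, x ≠ 0) → a k (l.map Neg.neg) = a k l + 1) (k : ℕ) (F : List SignType) :
    cupCochain a k (F.map Neg.neg) = cupCochain a k F := by
  induction k generalizing F with
  | zero => rfl
  | succ k ih =>
    simp only [cupCochain, cobd_map_neg, ih]
    rw [cobd_congr (ψ' := fun l => a k l * cupCochain a k l + cupCochain a k l), cobd_add]
    · rw [cobd_cupCochain, add_zero]
    · intro E _ hE
      rw [ha k E hE]
      ring

lemma hemiSum_cupCochain {a : ℕ → List SignType → ZMod 2}
    (ha : ∀ k l, (∃ x ∈ l, x ≠ 0) → a k (l.map Neg.neg) = a k l + 1) {k M : ℕ} (hk : k ≤ M)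
    {s : SignType} (hs : s ≠ 0) : hemiSum k M s (cupCochain a k) = 1 := by
  induction k with
  | zero => exact hemiSum_one M s
  | succ k ih =>
    rw [← ih (by omega)]
    refine (hemiSum_cobd k M hs _).trans ?_
    rw [hemiSum_neg, ← hemiSum_add]
    refine hemiSum_congr fun l hl => ?_
    rw [cupCochain_map_neg ha, ha k l (exists_ne_zero_of_mem_hemisphere (by omega) hs hl)]
    linear_combination CharTwo.add_self_eq_zero (a k l * cupCochain a k l)

/-- A combinatorial Borsuk–Ulam theorem: some cell of the alternating `d`-hemisphere sees both
values of each of `d` antipodal two-valued labellings. -/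
lemma exists_cell_forall_label {a : ℕ → List SignType → ZMod 2}
    (ha : ∀ k l, (∃ x ∈ l, x ≠ 0) → a k (l.map Neg.neg) = a k l + 1) {d M : ℕ} (hd : d ≤ M) :
    ∃ F ∈ hemisphere d M 1, ∀ k < d, ∀ c, ∃ E, IsFace E F ∧ a k E ≠ c := by
  obtain ⟨F, hF, hne⟩ : ∃ F ∈ hemisphere d M 1, cupCochain a d F ≠ 0 := by
    by_contra! h
    have h1 := hemiSum_cupCochain ha hd (s := 1) (by decide)
    rw [hemiSum_congr (ψ' := fun _ => 0) h] at h1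
    simp [hemiSum] at h1
  refine ⟨F, hF, fun k hk c => ?_⟩
  by_contra! hc
  refine hne ?_
  have key : ∀ m, k + 1 ≤ m → ∀ E, IsFace E F → cupCochain a m E = 0 := by
    intro m hm
    induction m, hm using Nat.le_induction with
    | base =>
      intro E hE
      rw [cupCochain, cobd_congr (ψ' := fun l => c * cupCochain a k l), cobd_const_mul,
        cobd_cupCochain, mul_zero]
      intro E' hE' _
      rw [hc E' (hE'.trans hE)]
    | succ m _ ih =>
      intro E hE
      rw [cupCochain, cobd_congr (ψ' := fun _ => 0), cobd_const]
      intro E' hE' _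
      rw [ih E' (hE'.trans hE), mul_zero]
  exact key d hk F (IsFace.refl F)

/-- The first nonzero sign of a word, as an element of `ZMod 2`. -/
def leadLabel : List SignType → ZMod 2
  | [] => 0
  | x :: l => if x = 1 then 1 else if x = -1 then 0 else leadLabel l

lemma leadLabel_map_neg {l : List SignType} (hl : ∃ x ∈ l, x ≠ 0) :
    leadLabel (l.map Neg.neg) = leadLabel l + 1 := by
  induction l with
  | nil => simp at hl
  | cons x l ih =>
    rcases x with _ | _ | _
    · have : ∃ x ∈ l, x ≠ 0 := by
        obtain ⟨x, hx, hx0⟩ := hl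
        rcases List.mem_cons.mp hx with rfl | hx
        · exact absurd rfl hx0
        · exact ⟨x, hx, hx0⟩
      exact ih this
    · rfl
    · rfl

/-- Real-valued form of `exists_cell_forall_label`. -/
lemma exists_cell_forall_sign {g : ℕ → List SignType → ℝ}
    (hg : ∀ k l, g k (l.map Neg.neg) = -g k l) {d M : ℕ} (hd : d ≤ M) :
    ∃ F ∈ hemisphere d M 1, ∀ k < d,
      (∃ E, IsFace E F ∧ 0 ≤ g k E) ∧ ∃ E, IsFace E F ∧ g k E ≤ 0 := by
  let a : ℕ → List SignType → ZMod 2 := fun k l =>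
    if 0 < g k l then 1 else if g k l < 0 then 0 else leadLabel l
  have ha : ∀ k l, (∃ x ∈ l, x ≠ 0) → a k (l.map Neg.neg) = a k l + 1 := by
    intro k l hl
    simp only [a, hg, leadLabel_map_neg hl]
    rcases lt_trichotomy (g k l) 0 with h | h | h
    · simp [h, h.le]
    · simp [h]
    · simp [h, h.le, CharTwo.add_self_eq_zero]
  obtain ⟨F, hF, h⟩ := exists_cell_forall_label ha hd
  refine ⟨F, hF, fun k hk => ⟨?_, ?_⟩⟩
  · obtain ⟨E, hE, hne⟩ := h k hk 0
    refine ⟨E, hE, ?_⟩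
    by_contra! hlt
    exact hne (by simp [a, hlt, hlt.le])
  · obtain ⟨E, hE, hne⟩ := h k hk 1
    refine ⟨E, hE, ?_⟩
    by_contra! hlt
    exact hne (by simp [a, hlt])

/-! ### From sign words to points of the solid cube -/

/-- The bias vector of a sign word: the density of `1` in each block of length `N`. -/
def blockBias {n : ℕ} (N : ℕ) (l : List SignType) (i : Fin n) : ℝ :=
  (∑ r ∈ range N, (1 + ((l.getD (i * N + r) 0 : SignType) : ℝ)) / 2) / N

lemma blockBias_map_neg {n N : ℕ} (hN : 0 < N) (l : List SignType) :
    blockBias (n := n) N (l.map Neg.neg) = 1 - blockBias N l := by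
  have hN' : (N : ℝ) ≠ 0 := by positivity
  have h0 : ∀ p, (l.map Neg.neg).getD p 0 = -(l.getD p 0) := by
    intro p
    have := List.getD_map (f := Neg.neg) (l := l) (n := p) (d := (0 : SignType))
    simpa using this
  funext i
  simp only [blockBias, Pi.sub_apply, Pi.one_apply, h0, SignType.coe_neg]
  rw [eq_sub_iff_add_eq, ← add_div, ← Finset.sum_add_distrib, div_eq_one_iff_eq hN']
  rw [Finset.sum_congr rfl (g := fun _ => (1 : ℝ)) (fun r _ => by ring)]
  simp

lemma signType_cast_abs_le (x : SignType) : |(x : ℝ)| ≤ 1 := by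
  rcases x with _ | _ | _ <;> norm_num

lemma blockBias_mem_Icc {n N : ℕ} (hN : 0 < N) (l : List SignType) (i : Fin n) :
    blockBias N l i ∈ Set.Icc (0 : ℝ) 1 := by
  have hN' : (0 : ℝ) < N := by positivity
  constructor
  · refine div_nonneg (Finset.sum_nonneg fun r _ => ?_) hN'.le
    have := abs_le.mp (signType_cast_abs_le (l.getD (i * N + r) 0))
    linarith [this.1]
  · rw [blockBias, div_le_one hN']
    calc _ ≤ ∑ r ∈ range N, (1 : ℝ) := Finset.sum_le_sum fun r _ => by
          have := abs_le.mp (signType_cast_abs_le (l.getD (i * N + r) 0))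
          linarith [this.2]
      _ = N := by simp

lemma block_index_lt {n N : ℕ} (i : Fin n) {r : ℕ} (hr : r < N) : i * N + r < n * N := by
  have : ((i : ℕ) + 1) * N ≤ n * N := Nat.mul_le_mul_right _ i.2
  nlinarith

lemma abs_blockBias_sub_le {n N k : ℕ} {s : SignType} (hs : s ≠ 0)
    {E F : List SignType} (hF : F ∈ hemisphere k (n * N) s) (hE : IsFace E F) (i : Fin n) :
    |blockBias N E i - blockBias N F i| ≤ k / N := by
  rw [blockBias, blockBias, ← sub_div, ← Finset.sum_sub_distrib, abs_div, Nat.abs_cast]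
  refine div_le_div_of_nonneg_right ?_ (Nat.cast_nonneg N)
  refine (Finset.abs_sum_le_sum_abs _ _).trans ?_
  calc _ ≤ ∑ r ∈ range N, (if F.getD (i * N + r) 0 = 0 then (1 : ℝ) else 0) := by
        refine Finset.sum_le_sum fun r _ => ?_
        split_ifs with h
        · rw [h]
          have := abs_le.mp (signType_cast_abs_le (E.getD (i * N + r) 0))
          rw [abs_le]
          constructor <;> simp only [SignType.coe_zero] <;> linarith [this.1, this.2]
        · rcases hE.getD (i * N + r) with h' | h'
          · rw [h', sub_self, abs_zero]
          · exact absurd h' h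
    _ = ∑ p ∈ (range N).image (fun r => i * N + r),
          (if F.getD p 0 = 0 then (1 : ℝ) else 0) := by
        rw [Finset.sum_image (fun _ _ _ _ h => Nat.add_left_cancel h)]
    _ ≤ ∑ p ∈ range (n * N), (if F.getD p 0 = 0 then (1 : ℝ) else 0) := by
        refine Finset.sum_le_sum_of_subset_of_nonneg ?_ fun _ _ _ => by split_ifs <;> norm_num
        intro p hp
        obtain ⟨r, hr, rfl⟩ := Finset.mem_image.mp hp
        exact Finset.mem_range.mpr (block_index_lt i (Finset.mem_range.mp hr))
    _ = k := by exact_mod_cast congrArg (Nat.cast (R := ℝ)) (sum_zeros_of_mem_hemisphere hs hF)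

/-- Bias vectors which are deterministic off `σ`. -/
def biasFace {n : ℕ} (σ : Finset (Fin n)) : Set (Fin n → ℝ) :=
  Set.univ.pi fun i => if i ∈ σ then Set.Icc 0 1 else {0, 1}

lemma isCompact_biasFace {n : ℕ} (σ : Finset (Fin n)) : IsCompact (biasFace σ) := by
  refine isCompact_univ_pi fun i => ?_
  split_ifs
  · exact isCompact_Icc
  · exact (Set.toFinite _).isCompact

lemma exists_blockBias_mem_biasFace {n N d : ℕ} (hdn : d ≤ n) (hN : 0 < N) {s : SignType}
    (hs : s ≠ 0) {F : List SignType} (hF : F ∈ hemisphere d (n * N) s) :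
    ∃ σ : Finset (Fin n), σ.card = d ∧ blockBias N F ∈ biasFace σ := by
  classical
  let Z := (range (n * N)).filter fun p => F.getD p 0 = 0
  have hZ : Z.card = d := by
    rw [Finset.card_filter]
    exact sum_zeros_of_mem_hemisphere hs hF
  let S : Finset (Fin n) := Finset.univ.filter fun i => ∃ r < N, F.getD (i * N + r) 0 = 0
  have hS : S.card ≤ d := by
    rw [← hZ, ← Finset.card_image_of_injective S Fin.val_injective]
    refine (Finset.card_le_card ?_).trans (Finset.card_image_le (s := Z) (f := fun p => p / N))
    intro p hp
    obtain ⟨i, hi, rfl⟩ := Finset.mem_image.mp hp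
    obtain ⟨r, hr, h0⟩ := (Finset.mem_filter.mp hi).2
    refine Finset.mem_image.mpr ⟨i * N + r, ?_, ?_⟩
    · exact Finset.mem_filter.mpr ⟨Finset.mem_range.mpr (block_index_lt i hr), h0⟩
    · rw [mul_comm, Nat.mul_add_div hN, Nat.div_eq_of_lt hr, add_zero]
  obtain ⟨σ, hSσ, hσ⟩ := Finset.exists_superset_card_eq hS (by simpa using hdn)
  refine ⟨σ, hσ, fun i _ => ?_⟩
  dsimp only
  split_ifs with hi
  · exact blockBias_mem_Icc hN F i
  · have hne : ∀ r < N, F.getD (i * N + r) 0 ≠ 0 := by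
      intro r hr h0
      exact hi (hSσ (Finset.mem_filter.mpr ⟨Finset.mem_univ _, r, hr, h0⟩))
    have hconst : ∀ r < N, F.getD (i * N + r) 0 = F.getD (i * N) 0 := by
      intro r
      induction r with
      | zero => simp
      | succ r ih =>
        intro hr
        rw [← ih (by omega)]
        rcases getD_succ_of_mem_hemisphere hF (i * N + r) with h | h | h
        · exact h.symm
        · exact absurd h (hne r (by omega))
        · exact absurd h (hne (r + 1) hr)
    have hN' : (N : ℝ) ≠ 0 := by positivity
    have hval : blockBias N F i = (1 + ((F.getD (i * N) 0 : SignType) : ℝ)) / 2 := by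
      rw [blockBias, Finset.sum_congr rfl fun r hr => by rw [hconst r (Finset.mem_range.mp hr)]]
      rw [Finset.sum_const, card_range, nsmul_eq_mul, mul_div_cancel_left₀ _ hN']
    have h0 := hne 0 hN
    rw [add_zero] at h0
    rw [hval]
    generalize F.getD (i * N) 0 = x at h0
    rcases x with _ | _ | _
    · exact absurd rfl h0
    · left; norm_num
    · right; norm_num

/-- A Borsuk–Ulam theorem for the `d`-skeleton of the cube `[0,1]^n`. -/
lemma exists_mem_biasFace_eq_zero {d n : ℕ} (hdn : d ≤ n) {G : (Fin n → ℝ) → Fin d → ℝ}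
    (hG : Continuous G) (hodd : ∀ α, G (1 - α) = -G α) :
    ∃ σ : Finset (Fin n), σ.card = d ∧ ∃ α ∈ biasFace σ, G α = 0 := by
  let K : Set (Fin n → ℝ) := ⋃ σ : {σ : Finset (Fin n) // σ.card = d}, biasFace σ.1
  have hK : IsCompact K := isCompact_iUnion fun σ => isCompact_biasFace σ.1
  have happrox : ∀ ε > 0, ∃ α ∈ K, ‖G α‖ < ε := by
    intro ε hε
    have hC : IsCompact (Set.univ.pi fun _ : Fin n => Set.Icc (0 : ℝ) 1) :=
      isCompact_univ_pi fun _ => isCompact_Icc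
    obtain ⟨δ, hδ, hunif⟩ := Metric.uniformContinuousOn_iff.mp
      (hC.uniformContinuousOn_of_continuous hG.continuousOn) ε hε
    obtain ⟨N, hN⟩ := exists_nat_gt ((d : ℝ) / δ)
    have hN0 : (0 : ℝ) < N := lt_of_le_of_lt (by positivity) hN
    have hNpos : 0 < N := by exact_mod_cast hN0
    have hdN : (d : ℝ) / N < δ := by
      rw [div_lt_iff₀ hδ] at hN
      rw [div_lt_iff₀ hN0]
      linarith
    let g : ℕ → List SignType → ℝ := fun k l =>
      if hk : k < d then G (blockBias N l) ⟨k, hk⟩ else 0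
    have hg : ∀ k l, g k (l.map Neg.neg) = -g k l := by
      intro k l
      simp only [g, blockBias_map_neg hNpos, hodd]
      split_ifs <;> simp
    obtain ⟨F, hF, hsign⟩ := exists_cell_forall_sign hg (d := d) (M := n * N)
      (hdn.trans (Nat.le_mul_of_pos_right n hNpos))
    obtain ⟨σ, hσ, hmem⟩ := exists_blockBias_mem_biasFace hdn hNpos (by decide) hF
    refine ⟨blockBias N F, Set.mem_iUnion.mpr ⟨⟨σ, hσ⟩, hmem⟩, ?_⟩
    have hclose : ∀ E, IsFace E F → ∀ k : Fin d,
        |G (blockBias N E) k - G (blockBias N F) k| < ε := by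
      intro E hE k
      have := hunif (blockBias N E) (fun i _ => blockBias_mem_Icc hNpos E i)
        (blockBias N F) (fun i _ => blockBias_mem_Icc hNpos F i)
        ((dist_pi_lt_iff hδ).mpr fun i =>
          (abs_blockBias_sub_le (by decide) hF hE i).trans_lt hdN)
      exact (dist_pi_lt_iff hε).mp this k
    refine (pi_norm_lt_iff hε).mpr fun k => ?_
    obtain ⟨⟨E, hE, h1⟩, E', hE', h2⟩ := hsign k k.2
    simp only [g, k.2, dif_pos, Fin.eta] at h1 h2
    have h3 := abs_lt.mp (hclose E hE k)
    have h4 := abs_lt.mp (hclose E' hE' k)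
    rw [Real.norm_eq_abs, abs_lt]
    constructor <;> linarith [h3.1, h3.2, h4.1, h4.2]
  obtain ⟨α₀, hα₀, -⟩ := happrox 1 one_pos
  obtain ⟨α, hα, hmin⟩ := hK.exists_isMinOn ⟨α₀, hα₀⟩ hG.norm.continuousOn
  obtain ⟨σ, hσ⟩ := Set.mem_iUnion.mp hα
  refine ⟨σ.1, σ.2, α, hσ, ?_⟩
  by_contra hne
  obtain ⟨β, hβ, hlt⟩ := happrox ‖G α‖ (norm_pos_iff.mpr hne)
  exact absurd (hmin hβ) (not_le.mpr hlt)

/-! ### The multilinear extension -/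

lemma biasedWeight_one_sub {n : ℕ} (α : Fin n → ℝ) (x : Fin n → Bool) :
    biasedWeight (1 - α) x = biasedWeight α (negc x) := by
  refine Finset.prod_congr rfl fun i _ => ?_
  cases h : x i <;> simp [negc, h]

lemma negc_involutive {n : ℕ} : Function.Involutive (negc : (Fin n → Bool) → _) := by
  intro x
  funext i
  simp [negc]

lemma sum_biasedWeight_one_sub {n : ℕ} {X : Type*} [AddCommGroup X] [Module ℝ X]
    (α : Fin n → ℝ) (f : (Fin n → Bool) → X) :
    ∑ x, biasedWeight (1 - α) x • f x = ∑ x, biasedWeight α x • f (negc x) := by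
  refine Fintype.sum_equiv negc_involutive.toPerm _ _ fun x => ?_
  simp [biasedWeight_one_sub, negc_involutive x]

lemma sum_biasedWeight_eq_sum_glue {n : ℕ} {X : Type*} [AddCommGroup X] [Module ℝ X]
    {σ : Finset (Fin n)} {α : Fin n → ℝ} {w : Fin n → Bool}
    (hw : ∀ i ∉ σ, α i = if w i then 1 else 0) (f : (Fin n → Bool) → X) :
    ∑ x, biasedWeight α x • f x =
      ∑ x : {i // i ∈ σ} → Bool, biasedWeight (fun i : {i // i ∈ σ} => α i) x • f (glue σ x w) := by
  symm
  refine Finset.sum_of_injOn (fun x => glue σ x w) ?_ (by simp) ?_ ?_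
  · intro x _ y _ hxy
    funext i
    have := congrFun hxy i.1
    simpa [glue, i.2] using this
  · intro x _ hx
    have : ∃ i ∉ σ, x i ≠ w i := by
      by_contra! h
      refine hx ⟨fun i => x i, by simp, ?_⟩
      funext i
      by_cases hi : i ∈ σ
      · simp [glue, hi]
      · simp [glue, hi, h i hi]
    obtain ⟨i, hi, hne⟩ := this
    have h0 : biasedWeight α x = 0 := by
      refine Finset.prod_eq_zero (Finset.mem_univ i) ?_
      rw [hw i hi]
      cases h1 : x i <;> cases h2 : w i <;> simp_all
    rw [h0, zero_smul]
  · intro x _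
    congr 1
    have hoff : ∀ i ∈ (Finset.univ : Finset (Fin n)), i ∉ σ →
        (if glue σ x w i then α i else 1 - α i) = 1 := by
      intro i _ hi
      rw [hw i hi]
      cases h : w i <;> simp [glue, hi, h]
    rw [biasedWeight, biasedWeight, ← Finset.prod_subset (Finset.subset_univ σ) hoff,
      ← Finset.prod_coe_sort σ]
    refine Finset.prod_congr rfl fun i _ => ?_
    simp [glue]

lemma negc_glue {n : ℕ} (σ : Finset (Fin n)) (x : {i // i ∈ σ} → Bool) (w : Fin n → Bool) :
    negc (glue σ x w) = glue σ (fun i => !(x i)) (fun j => !(w j)) := by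
  funext i
  by_cases hi : i ∈ σ <;> simp [negc, glue, hi]

/-- The topological lemma: for every `f : {-1,1}^n → ℝ^d` with
`1 ≤ d < n` there exist a `d`-element set of coordinates `σ`, a bias vector
`𝛂 ∈ [0,1]^σ` and a point `w ∈ {-1,1}^{σᶜ}` such that the `μ_𝛂`-averages of `f` over
the subcube `{-1,1}^σ × {w}` and over its antipode `{-1,1}^σ × {-w}` coincide. -/
theorem stmt19 (d n : ℕ) (hd : 1 ≤ d) (hdn : d < n)
    (f : (Fin n → Bool) → Fin d → ℝ) :
    ∃ (σ : Finset (Fin n)) (a : {i // i ∈ σ} → ℝ) (w : Fin n → Bool),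
      σ.card = d ∧ (∀ i, 0 ≤ a i ∧ a i ≤ 1) ∧
      ∑ x : {i // i ∈ σ} → Bool, biasedWeight a x • f (glue σ x w) =
        ∑ x : {i // i ∈ σ} → Bool, biasedWeight a x •
          f (glue σ (fun i => !(x i)) (fun j => !(w j))) := by
  let G : (Fin n → ℝ) → Fin d → ℝ := fun α =>
    ∑ x, biasedWeight α x • f x - ∑ x, biasedWeight (1 - α) x • f x
  have hweight : ∀ x : Fin n → Bool, Continuous fun α : Fin n → ℝ => biasedWeight α x := by
    intro x
    refine continuous_finsetProd _ fun i _ => ?_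
    split_ifs <;> fun_prop
  have hG : Continuous G := by
    refine Continuous.sub ?_ ?_
    · exact continuous_finsetSum _ fun x _ => (hweight x).smul continuous_const
    · exact continuous_finsetSum _ fun x _ =>
        ((hweight x).comp (continuous_const.sub continuous_id)).smul continuous_const
  obtain ⟨σ, hσ, α, hα, h0⟩ := exists_mem_biasFace_eq_zero hdn.le hG fun α => by simp [G]
  have hmem : ∀ i, α i ∈ if i ∈ σ then Set.Icc (0 : ℝ) 1 else {0, 1} := fun i => hα i trivial
  have hw : ∀ i ∉ σ, α i = if decide (α i = 1) then 1 else 0 := by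
    intro i hi
    have := hmem i
    rw [if_neg hi] at this
    rcases this with h | h <;> simp_all
  refine ⟨σ, fun i => α i, fun i => decide (α i = 1), hσ, fun i => ?_, ?_⟩
  · have := hmem i
    rwa [if_pos i.2] at this
  · have h1 := sub_eq_zero.mp h0
    rw [sum_biasedWeight_one_sub, sum_biasedWeight_eq_sum_glue hw f,
      sum_biasedWeight_eq_sum_glue hw fun x => f (negc x)] at h1
    simpa only [negc_glue] using h1
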